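/- arXiv:1911.00645 — 2 statements merged into one kernel-verified Lean document; each statement's English description precedes it below -/
import Mathlib

section
/- Let d ≥ 1, L ≥ 2 and W_1,…,W_L ∈ ℝ^{d×d}. Set α = max{max_{1≤l≤L−1} ‖W_l‖₂, 1} and β = ‖W_L‖₂. Assume ‖D_l‖₂ ≤ δ for l = 1,…,L−2 with δ ≤ (2 L³)^{−1}, and ‖I + D_{L−1}‖₂ ≤ ε with ε ≤ (4 L²)^{−1}. Then ‖W_{L:1} W_{L:1}ᵀ‖₂ ≥ (1/2) α^{2(L−1)} β². -/
open Matrix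

namespace ZAS

/-- `seg W l₁ l₂ = W l₂ * W (l₂-1) * ⋯ * W l₁` (the empty product, when `l₂ < l₁`, is `1`). -/
noncomputable def seg {d : ℕ} (W : ℕ → Matrix (Fin d) (Fin d) ℝ) (l₁ : ℕ) :
    ℕ → Matrix (Fin d) (Fin d) ℝ
  | 0 => 1
  | (k+1) => if k + 1 < l₁ then 1 else W (k+1) * seg W l₁ k

/-- Squared Frobenius norm `‖A‖_F²`. -/
noncomputable def frobSq {m n : ℕ} (A : Matrix (Fin m) (Fin n) ℝ) : ℝ :=
  ∑ i, ∑ j, (A i j)^2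

/-- Frobenius norm `‖A‖_F`. -/
noncomputable def frob {m n : ℕ} (A : Matrix (Fin m) (Fin n) ℝ) : ℝ :=
  Real.sqrt (frobSq A)

/-- Frobenius inner product `⟨A, B⟩ = tr(Aᵀ B)`. -/
noncomputable def finner {m n : ℕ} (A B : Matrix (Fin m) (Fin n) ℝ) : ℝ :=
  ∑ i, ∑ j, A i j * B i j

/-- The loss `R(W_1, …, W_L) = (1/2) ‖W_{L:1} - Φ‖_F²`. -/
noncomputable def loss {d : ℕ} (W : ℕ → Matrix (Fin d) (Fin d) ℝ)
    (Φ : Matrix (Fin d) (Fin d) ℝ) (L : ℕ) : ℝ :=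
  frobSq (seg W 1 L - Φ) / 2

/-- The gradient `∇_l R = W_{L:l+1}ᵀ (W_{L:1} - Φ) W_{l-1:1}ᵀ`. -/
noncomputable def grad {d : ℕ} (W : ℕ → Matrix (Fin d) (Fin d) ℝ)
    (Φ : Matrix (Fin d) (Fin d) ℝ) (L l : ℕ) : Matrix (Fin d) (Fin d) ℝ :=
  (seg W (l+1) L)ᵀ * (seg W 1 L - Φ) * (seg W 1 (l-1))ᵀ

/-- The invariant matrices `D_l = W_{l+1}ᵀ W_{l+1} - W_l W_lᵀ`. -/
noncomputable def Dmat {d : ℕ} (W : ℕ → Matrix (Fin d) (Fin d) ℝ) (l : ℕ) :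
    Matrix (Fin d) (Fin d) ℝ :=
  (W (l+1))ᵀ * W (l+1) - W l * (W l)ᵀ

/-- Spectral norm (operator 2-norm) of a square real matrix. -/
noncomputable def spec {d : ℕ} (A : Matrix (Fin d) (Fin d) ℝ) : ℝ :=
  ‖Matrix.toEuclideanCLM (𝕜 := ℝ) A‖

/-- The loss on data: `R̃ = (1/2) ‖W_{L:1} X - Y‖_F²`. -/
noncomputable def lossT {d n : ℕ} (W : ℕ → Matrix (Fin d) (Fin d) ℝ)
    (X Y : Matrix (Fin d) (Fin n) ℝ) (L : ℕ) : ℝ :=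
  frobSq (seg W 1 L * X - Y) / 2

/-- The gradient of the data loss: `∇_l R̃ = W_{L:l+1}ᵀ (W_{L:1} X - Y) Xᵀ W_{l-1:1}ᵀ`. -/
noncomputable def gradT {d n : ℕ} (W : ℕ → Matrix (Fin d) (Fin d) ℝ)
    (X Y : Matrix (Fin d) (Fin n) ℝ) (L l : ℕ) : Matrix (Fin d) (Fin d) ℝ :=
  (seg W (l+1) L)ᵀ * (seg W 1 L * X - Y) * Xᵀ * (seg W 1 (l-1))ᵀ

end ZAS

open ZAS

section InnerProduct

variable {E : Type*} [NormedAddCommGroup E] [InnerProductSpace ℝ E] [FiniteDimensional ℝ E]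

theorem inner_mul_star_apply_self (T : E →L[ℝ] E) (x : E) :
    inner ℝ x ((T * star T) x) = ‖star T x‖ ^ 2 := by
  rw [mul_apply_eq_comp, ← real_inner_self_eq_norm_sq,
    ContinuousLinearMap.star_eq_adjoint, ContinuousLinearMap.adjoint_inner_left]

theorem inner_star_mul_apply_self (T : E →L[ℝ] E) (x : E) :
    inner ℝ x ((star T * T) x) = ‖T x‖ ^ 2 := by
  simpa using inner_mul_star_apply_self (star T) x

theorem exists_norm_le_one_norm_apply_eq (T : E →L[ℝ] E) :
    ∃ u : E, ‖u‖ ≤ 1 ∧ ‖T u‖ = ‖T‖ := by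
  obtain ⟨u, hu, hmax⟩ := (isCompact_closedBall (0 : E) 1).exists_isMaxOn
    ⟨0, by simp⟩ (T.continuous.norm.continuousOn)
  have hu1 : ‖u‖ ≤ 1 := by simpa using hu
  refine ⟨u, hu1, le_antisymm (T.unit_le_opNorm u hu1) ?_⟩
  refine T.opNorm_le_of_unit_norm (norm_nonneg _) fun x hx => ?_
  exact hmax (by simp [hx])

/-- A lower bound on the growth of `star S` along `u` propagates to the growth of `star T`
along `star S u` when `star S * S` and `T * star T` nearly agree up to a multiple of `1`. -/
theorem norm_sq_star_apply_star_apply_ge {S T : E →L[ℝ] E} {c t δ : ℝ} {u : E}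
    (hu : c * ‖u‖ ^ 2 ≤ ‖star S u‖ ^ 2)
    (h : ‖t • (1 : E →L[ℝ] E) + (star S * S - T * star T)‖ ≤ δ) :
    (c + t - δ) * ‖star S u‖ ^ 2 ≤ ‖star T (star S u)‖ ^ 2 := by
  set x := star S u with hx
  have hcs : (‖x‖ ^ 2) ^ 2 ≤ ‖u‖ ^ 2 * ‖S x‖ ^ 2 := by
    have h1 : ‖x‖ ^ 2 ≤ ‖u‖ * ‖S x‖ := by
      rw [← inner_mul_star_apply_self, mul_apply_eq_comp, ← hx]
      exact real_inner_le_norm _ _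
    rw [← mul_pow]
    exact pow_le_pow_left₀ (by positivity) h1 2
  have hq : t * ‖x‖ ^ 2 + (‖S x‖ ^ 2 - ‖star T x‖ ^ 2) ≤ δ * ‖x‖ ^ 2 := by
    rw [← inner_star_mul_apply_self S, ← inner_mul_star_apply_self T,
      ← real_inner_self_eq_norm_sq x, ← inner_sub_right, ← real_inner_smul_right,
      ← inner_add_right, real_inner_self_eq_norm_sq x]
    calc inner ℝ x (t • x + ((star S * S) x - (T * star T) x))
        = inner ℝ x ((t • (1 : E →L[ℝ] E) + (star S * S - T * star T)) x) := by simp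
      _ ≤ ‖x‖ * ‖(t • (1 : E →L[ℝ] E) + (star S * S - T * star T)) x‖ :=
          real_inner_le_norm _ _
      _ ≤ ‖x‖ * (δ * ‖x‖) := by
          gcongr
          exact ContinuousLinearMap.le_of_opNorm_le _ h x
      _ = δ * ‖x‖ ^ 2 := by ring
  have hSx : c * ‖x‖ ^ 2 ≤ ‖S x‖ ^ 2 := by
    rcases (sq_nonneg ‖x‖).eq_or_lt with h0 | hpos
    · rw [← h0, mul_zero]
      positivity
    · rcases le_or_gt c 0 with hc | hc
      · exact (mul_nonpos_of_nonpos_of_nonneg hc hpos.le).trans (sq_nonneg _)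
      · refine le_of_mul_le_mul_right ?_ hpos
        calc c * ‖x‖ ^ 2 * ‖x‖ ^ 2 = c * (‖x‖ ^ 2) ^ 2 := by ring
          _ ≤ c * (‖u‖ ^ 2 * ‖S x‖ ^ 2) := by gcongr
          _ = c * ‖u‖ ^ 2 * ‖S x‖ ^ 2 := by ring
          _ ≤ ‖x‖ ^ 2 * ‖S x‖ ^ 2 := by gcongr
          _ = ‖S x‖ ^ 2 * ‖x‖ ^ 2 := by ring
  linarith

theorem norm_sq_star_prod_apply_ge {T P : ℕ → E →L[ℝ] E} (hP0 : P 0 = 1)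
    (hP : ∀ k, P (k + 1) = T (k + 1) * P k) {b δ : ℝ} (hb : 0 ≤ b) (hδ : 0 ≤ δ) (m : ℕ) :
    ∀ (u : E) (c : ℝ),
      (∀ l, 1 ≤ l → l < m → ‖star (T (l + 1)) * T (l + 1) - T l * star (T l)‖ ≤ δ) →
      c * ‖u‖ ^ 2 ≤ ‖star (T m) u‖ ^ 2 → b + m * δ ≤ c →
      b ^ m * ‖u‖ ^ 2 ≤ ‖star (P m) u‖ ^ 2 := by
  induction m with
  | zero => intro u c _ _ _; simp [hP0]
  | succ m ih =>
    intro u c hD hu hc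
    have hbc : b ≤ c := le_trans (le_add_of_nonneg_right (by positivity)) hc
    rw [hP, star_mul, mul_apply_eq_comp]
    have hrest : b ^ m * ‖star (T (m + 1)) u‖ ^ 2
        ≤ ‖star (P m) (star (T (m + 1)) u)‖ ^ 2 := by
      rcases Nat.eq_zero_or_pos m with rfl | hm
      · simp [hP0]
      · refine ih _ (c + 0 - δ) (fun l h1 h2 => hD l h1 (by omega)) ?_ ?_
        · exact norm_sq_star_apply_star_apply_ge hu (by simpa using hD m hm (by omega))
        · push_cast at hc
          linarith
    calc b ^ (m + 1) * ‖u‖ ^ 2 = b ^ m * (b * ‖u‖ ^ 2) := by ring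
      _ ≤ b ^ m * (c * ‖u‖ ^ 2) := by gcongr
      _ ≤ b ^ m * ‖star (T (m + 1)) u‖ ^ 2 := by gcongr
      _ ≤ _ := hrest

theorem norm_sq_le_of_norm_smul_one_add_le {S T : E →L[ℝ] E} {t δ : ℝ} (ht : 0 ≤ t)
    (h : ‖t • (1 : E →L[ℝ] E) + (star S * S - T * star T)‖ ≤ δ) :
    ‖T‖ ^ 2 ≤ ‖S‖ ^ 2 + t + δ := by
  have h1 : T * star T = star S * S + t • (1 : E →L[ℝ] E)
      - (t • (1 : E →L[ℝ] E) + (star S * S - T * star T)) := by abel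
  have h2 : ‖t • (1 : E →L[ℝ] E)‖ ≤ t := by
    rw [norm_smul, Real.norm_of_nonneg ht]
    exact mul_le_of_le_one_right ht ContinuousLinearMap.norm_id_le
  calc ‖T‖ ^ 2 = ‖T * star T‖ := by rw [CStarRing.norm_self_mul_star (x := T), sq]
    _ ≤ ‖star S * S‖ + ‖t • (1 : E →L[ℝ] E)‖
        + ‖t • (1 : E →L[ℝ] E) + (star S * S - T * star T)‖ := by
        conv_lhs => rw [h1]
        exact (norm_sub_le _ _).trans (by gcongr; exact norm_add_le _ _)
    _ ≤ ‖S‖ ^ 2 + t + δ := by rw [CStarRing.norm_star_mul_self (x := S), ← sq]; gcongr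

theorem norm_sq_le_of_approx_balanced {T : ℕ → E →L[ℝ] E} {δ : ℝ} {l : ℕ} (m : ℕ)
    (h : ∀ k, l ≤ k → k < l + m →
      ‖star (T (k + 1)) * T (k + 1) - T k * star (T k)‖ ≤ δ) :
    ‖T l‖ ^ 2 ≤ ‖T (l + m)‖ ^ 2 + m * δ := by
  induction m with
  | zero => simp
  | succ m ih =>
    have h1 := ih fun k h1 h2 => h k h1 (by omega)
    have h2 := norm_sq_le_of_norm_smul_one_add_le (t := 0) (S := T (l + m + 1)) le_rfl
      (by simpa using h (l + m) (by omega) (by omega))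
    rw [← add_assoc]
    push_cast
    linarith

end InnerProduct

theorem half_pow_le_pow_of_near {L : ℕ} (hL : 2 ≤ L) {a s : ℝ} (ha : 1 ≤ a)
    (has : a ≤ s + (4 * (L : ℝ) ^ 2)⁻¹ + (L - 1) * (2 * (L : ℝ) ^ 3)⁻¹) :
    0 ≤ s - (4 * (L : ℝ) ^ 2)⁻¹ - (L - 1) * (2 * (L : ℝ) ^ 3)⁻¹ ∧
    1 / 2 * a ^ (L - 1) ≤
      (s - (4 * (L : ℝ) ^ 2)⁻¹ - (L - 1) * (2 * (L : ℝ) ^ 3)⁻¹) ^ (L - 1) := by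
  have hL2 : (2 : ℝ) ≤ L := by exact_mod_cast hL
  have hL0 : (0 : ℝ) < L := by linarith
  set η : ℝ := 3 / (2 * (L : ℝ) ^ 2) with hη
  have hη0 : 0 ≤ η := by positivity
  have hη1 : η ≤ 3 / 8 := by
    rw [hη, div_le_div_iff₀ (by positivity) (by norm_num)]
    nlinarith
  have hsum : 2 * ((4 * (L : ℝ) ^ 2)⁻¹ + (L - 1) * (2 * (L : ℝ) ^ 3)⁻¹) ≤ η := by
    have h1 : η - 2 * ((4 * (L : ℝ) ^ 2)⁻¹ + (L - 1) * (2 * (L : ℝ) ^ 3)⁻¹)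
        = ((L : ℝ) ^ 3)⁻¹ := by
      rw [hη]
      field_simp
      ring
    have h2 : 0 ≤ ((L : ℝ) ^ 3)⁻¹ := by positivity
    linarith
  have hηL : ((L : ℝ) - 1) * η ≤ 1 / 2 := by
    rw [hη, mul_div_assoc', div_le_div_iff₀ (by positivity) (by norm_num)]
    nlinarith [sq_nonneg ((L : ℝ) - 2)]
  have hle : (1 - η) * a ≤ s - (4 * (L : ℝ) ^ 2)⁻¹ - (L - 1) * (2 * (L : ℝ) ^ 3)⁻¹ := by
    nlinarith
  have h0 : 0 ≤ (1 - η) * a := mul_nonneg (by linarith) (by linarith)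
  refine ⟨h0.trans hle, ?_⟩
  have hbern : 1 / 2 ≤ (1 - η) ^ (L - 1) := by
    have := one_add_mul_le_pow (a := -η) (by linarith) (L - 1)
    rw [Nat.cast_sub (by omega), Nat.cast_one] at this
    rw [sub_eq_add_neg 1 η]
    linarith
  calc 1 / 2 * a ^ (L - 1) ≤ (1 - η) ^ (L - 1) * a ^ (L - 1) := by gcongr
    _ = ((1 - η) * a) ^ (L - 1) := (mul_pow _ _ _).symm
    _ ≤ _ := pow_le_pow_left₀ h0 hle _

theorem toEuclideanCLM_transpose {d : ℕ} (A : Matrix (Fin d) (Fin d) ℝ) :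
    Matrix.toEuclideanCLM (𝕜 := ℝ) Aᵀ = star (Matrix.toEuclideanCLM (𝕜 := ℝ) A) := by
  rw [← map_star, Matrix.star_eq_conjTranspose, Matrix.conjTranspose_eq_transpose_of_trivial]

/-- with `α = max{max_l ‖W_l‖₂, 1}` and `β = ‖W_L‖₂`, approximate
balancedness with `δ ≤ (2L³)⁻¹`, `ε ≤ (4L²)⁻¹` implies
`‖W_{L:1} W_{L:1}ᵀ‖₂ ≥ (1/2) α^{2(L-1)} β²`. -/
theorem approx_balanced_product_norm_lower_bound
    (d L : ℕ) (hd : 1 ≤ d) (hL : 2 ≤ L)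
    (W : ℕ → Matrix (Fin d) (Fin d) ℝ) (α β δ ε : ℝ)
    (hα : α = max ((Finset.Icc 1 (L-1)).sup' (Finset.nonempty_Icc.mpr (by omega))
      fun l => spec (W l)) 1)
    (hβ : β = spec (W L))
    (hD : ∀ l, 1 ≤ l → l ≤ L - 2 → spec (Dmat W l) ≤ δ)
    (hδ : δ ≤ (2 * (L:ℝ)^3)⁻¹)
    (hDL : spec (1 + Dmat W (L-1)) ≤ ε)
    (hε : ε ≤ (4 * (L:ℝ)^2)⁻¹) :
    1/2 * α^(2*(L-1)) * β^2 ≤ spec (seg W 1 L * (seg W 1 L)ᵀ) := by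
  set T : ℕ → EuclideanSpace ℝ (Fin d) →L[ℝ] EuclideanSpace ℝ (Fin d) :=
    fun l => Matrix.toEuclideanCLM (𝕜 := ℝ) (W l) with hT
  set P : ℕ → EuclideanSpace ℝ (Fin d) →L[ℝ] EuclideanSpace ℝ (Fin d) :=
    fun l => Matrix.toEuclideanCLM (𝕜 := ℝ) (seg W 1 l) with hPdef
  have hP0 : P 0 = 1 := by simp [hPdef, seg]
  have hP : ∀ k, P (k + 1) = T (k + 1) * P k := fun k => by simp [hPdef, hT, seg]
  have hDmat : ∀ l, Matrix.toEuclideanCLM (𝕜 := ℝ) (Dmat W l) =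
      star (T (l + 1)) * T (l + 1) - T l * star (T l) := fun l => by
    simp only [Dmat, map_sub, map_mul, toEuclideanCLM_transpose, hT]
  obtain ⟨m, rfl⟩ : ∃ m, L = m + 1 := ⟨L - 1, by omega⟩
  have hδ0 : (0 : ℝ) ≤ (2 * ((m + 1 : ℕ) : ℝ) ^ 3)⁻¹ := by positivity
  have hbal : ∀ l, 1 ≤ l → l < m →
      ‖star (T (l + 1)) * T (l + 1) - T l * star (T l)‖ ≤ (2 * ((m + 1 : ℕ) : ℝ) ^ 3)⁻¹ := by
    intro l h1 h2
    rw [← hDmat]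
    exact (hD l h1 (by omega)).trans hδ
  have htop : ‖(1 : ℝ) • (1 : EuclideanSpace ℝ (Fin d) →L[ℝ] EuclideanSpace ℝ (Fin d))
      + (star (T (m + 1)) * T (m + 1) - T m * star (T m))‖
      ≤ (4 * ((m + 1 : ℕ) : ℝ) ^ 2)⁻¹ := by
    rw [one_smul, ← hDmat, ← map_one (Matrix.toEuclideanCLM (n := Fin d) (𝕜 := ℝ)), ← map_add]
    exact hDL.trans hε
  rw [Nat.add_sub_cancel] at hDL ⊢
  have hβT : β = ‖T (m + 1)‖ := hβ
  have hα1 : 1 ≤ α := hα ▸ le_max_right _ _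
  have hm : (((m + 1 : ℕ) : ℝ) - 1) = m := by push_cast; ring
  have hαsq : α ^ 2 ≤ (β ^ 2 + 1) + (4 * ((m + 1 : ℕ) : ℝ) ^ 2)⁻¹
      + (((m + 1 : ℕ) : ℝ) - 1) * (2 * ((m + 1 : ℕ) : ℝ) ^ 3)⁻¹ := by
    rw [hm]
    rcases max_choice ((Finset.Icc 1 (m + 1 - 1)).sup' (Finset.nonempty_Icc.mpr (by omega))
      fun l => spec (W l)) 1 with h | h
    · obtain ⟨l, hl, hsup⟩ := Finset.exists_mem_eq_sup'
        (Finset.nonempty_Icc.mpr (show 1 ≤ m + 1 - 1 by omega)) fun l => spec (W l)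
      rw [Finset.mem_Icc, Nat.add_sub_cancel] at hl
      have hαl : α = ‖T l‖ := by rw [hα, h, hsup]; rfl
      have h1 := norm_sq_le_of_approx_balanced (T := T) (l := l) (m - l)
        fun k h1 h2 => hbal k (by omega) (by omega)
      rw [Nat.add_sub_cancel' hl.2] at h1
      have h2 := norm_sq_le_of_norm_smul_one_add_le zero_le_one htop
      have h3 : ((m - l : ℕ) : ℝ) ≤ m := by exact_mod_cast Nat.sub_le _ _
      have h4 := mul_le_mul_of_nonneg_right h3 hδ0
      rw [hαl, hβT]
      linarith
    · rw [hα, h]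
      have h1 : (0 : ℝ) ≤ (4 * ((m + 1 : ℕ) : ℝ) ^ 2)⁻¹ := by positivity
      have h2 := mul_nonneg (Nat.cast_nonneg (α := ℝ) m) hδ0
      nlinarith [sq_nonneg β]
  obtain ⟨hb, hpow⟩ := half_pow_le_pow_of_near hL (one_le_pow₀ hα1) hαsq
  rw [Nat.add_sub_cancel, hm] at hpow
  rw [hm] at hb
  obtain ⟨u, hu1, hu⟩ := exists_norm_le_one_norm_apply_eq (star (T (m + 1)))
  rw [norm_star (T (m + 1)), ← hβT] at hu
  have hstart : β ^ 2 * ‖u‖ ^ 2 ≤ ‖star (T (m + 1)) u‖ ^ 2 := by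
    rw [hu]
    exact mul_le_of_le_one_right (sq_nonneg _) (pow_le_one₀ (norm_nonneg _) hu1)
  have hprod := norm_sq_star_prod_apply_ge hP0 hP hb hδ0 m _ _ hbal
    (norm_sq_star_apply_star_apply_ge hstart htop) (by linarith)
  rw [hu] at hprod
  calc 1 / 2 * α ^ (2 * m) * β ^ 2 = 1 / 2 * (α ^ 2) ^ m * β ^ 2 := by rw [pow_mul]
    _ ≤ _ := mul_le_mul_of_nonneg_right hpow (sq_nonneg β)
    _ ≤ _ := hprod
    _ = ‖star (P (m + 1)) u‖ ^ 2 := by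
        rw [hP, star_mul, mul_apply_eq_comp]
    _ ≤ ‖star (P (m + 1))‖ ^ 2 := by
        gcongr
        exact ContinuousLinearMap.unit_le_opNorm _ u hu1
    _ = spec (seg W 1 (m + 1) * (seg W 1 (m + 1))ᵀ) := by
        rw [spec, map_mul, toEuclideanCLM_transpose, norm_star (P (m + 1)), sq]
        exact (CStarRing.norm_self_mul_star (x := P (m + 1))).symm
end

section
/- Let d ≥ 1, L ≥ 2, Φ ∈ ℝ^{d×d}, φ > 0, and W_1,…,W_L ∈ ℝ^{d×d}. Assume ‖W_l‖₂ ≤ α for l = 1,…,L−1 and ‖W_L‖₂ ≤ β, where 1 ≤ α^{2(L−1)} < L φ² and α^{2(L−1)} β² < 2 φ². Then ‖∇_l R‖_F² ≤ 4 φ² R for every l = 1,…,L−1, and ‖∇_L R‖_F² ≤ 2 L φ² R. -/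
open Matrix

namespace ZAS

theorem frobSq_nonneg {m n : ℕ} (A : Matrix (Fin m) (Fin n) ℝ) : 0 ≤ frobSq A :=
  Finset.sum_nonneg fun _ _ => Finset.sum_nonneg fun _ _ => sq_nonneg _

theorem frobSq_transpose {m n : ℕ} (A : Matrix (Fin m) (Fin n) ℝ) : frobSq Aᵀ = frobSq A :=
  Finset.sum_comm

theorem spec_nonneg {d : ℕ} (A : Matrix (Fin d) (Fin d) ℝ) : 0 ≤ spec A :=
  norm_nonneg _

theorem spec_one_le {d : ℕ} : spec (1 : Matrix (Fin d) (Fin d) ℝ) ≤ 1 := by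
  unfold spec
  rw [map_one]
  exact ContinuousLinearMap.norm_id_le

theorem spec_mul_le {d : ℕ} (A B : Matrix (Fin d) (Fin d) ℝ) :
    spec (A * B) ≤ spec A * spec B := by
  unfold spec
  rw [map_mul]
  exact norm_mul_le _ _

theorem spec_transpose {d : ℕ} (A : Matrix (Fin d) (Fin d) ℝ) : spec Aᵀ = spec A := by
  rw [← conjTranspose_eq_transpose_of_trivial]
  exact l2_opNorm_conjTranspose A

theorem sum_mulVec_sq_le {d : ℕ} (A : Matrix (Fin d) (Fin d) ℝ) (v : Fin d → ℝ) :
    ∑ i, (A *ᵥ v) i ^ 2 ≤ spec A ^ 2 * ∑ i, v i ^ 2 := by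
  have h := pow_le_pow_left₀ (norm_nonneg _)
    ((Matrix.toEuclideanCLM (𝕜 := ℝ) A).le_opNorm (WithLp.toLp 2 v)) 2
  rw [mul_pow, EuclideanSpace.real_norm_sq_eq, EuclideanSpace.real_norm_sq_eq] at h
  simpa [spec] using h

theorem frobSq_mul_le {d n : ℕ} (A : Matrix (Fin d) (Fin d) ℝ) (B : Matrix (Fin d) (Fin n) ℝ) :
    frobSq (A * B) ≤ spec A ^ 2 * frobSq B := by
  rw [← frobSq_transpose, ← frobSq_transpose B]
  unfold frobSq
  rw [Finset.mul_sum]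
  exact Finset.sum_le_sum fun j _ => sum_mulVec_sq_le A fun i => B i j

theorem frobSq_mul_le' {m d : ℕ} (A : Matrix (Fin m) (Fin d) ℝ) (B : Matrix (Fin d) (Fin d) ℝ) :
    frobSq (A * B) ≤ spec B ^ 2 * frobSq A := by
  rw [← frobSq_transpose, transpose_mul, ← spec_transpose, ← frobSq_transpose A]
  exact frobSq_mul_le _ _

theorem frobSq_transpose_mul_mul_transpose_le {d : ℕ} (S M T : Matrix (Fin d) (Fin d) ℝ) :
    frobSq (Sᵀ * M * Tᵀ) ≤ (spec S * spec T) ^ 2 * frobSq M := by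
  calc frobSq (Sᵀ * M * Tᵀ) ≤ spec Tᵀ ^ 2 * (spec Sᵀ ^ 2 * frobSq M) :=
        (frobSq_mul_le' _ _).trans
          (mul_le_mul_of_nonneg_left (frobSq_mul_le _ _) (sq_nonneg _))
    _ = (spec S * spec T) ^ 2 * frobSq M := by
        rw [spec_transpose, spec_transpose]; ring

theorem seg_of_lt {d : ℕ} (W : ℕ → Matrix (Fin d) (Fin d) ℝ) {l k : ℕ} (h : k < l) :
    seg W l k = 1 := by
  cases k with
  | zero => rfl
  | succ k => simp [seg, h]

theorem seg_succ {d : ℕ} (W : ℕ → Matrix (Fin d) (Fin d) ℝ) {l k : ℕ} (h : l ≤ k + 1) :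
    seg W l (k + 1) = W (k + 1) * seg W l k := by
  simp [seg, h]

theorem spec_seg_le {d : ℕ} {W : ℕ → Matrix (Fin d) (Fin d) ℝ} {α : ℝ} (hα : 0 ≤ α) {l k : ℕ}
    (hl : 1 ≤ l) (hW : ∀ j, l ≤ j → j ≤ k → spec (W j) ≤ α) :
    spec (seg W l k) ≤ α ^ (k + 1 - l) := by
  induction k with
  | zero =>
    rw [seg_of_lt W hl, Nat.sub_eq_zero_of_le (by omega), pow_zero]
    exact spec_one_le
  | succ k ih =>
    rcases Nat.lt_or_ge (k + 1) l with h | h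
    · rw [seg_of_lt W h, Nat.sub_eq_zero_of_le (by omega), pow_zero]
      exact spec_one_le
    · rw [seg_succ W h, Nat.succ_sub h, pow_succ']
      exact (spec_mul_le _ _).trans <| mul_le_mul (hW _ h le_rfl)
        (ih fun j h₁ h₂ => hW j h₁ (h₂.trans k.le_succ)) (spec_nonneg _) hα

end ZAS

open ZAS
/-- Lemma A.4: under the weight bounds, `‖∇_l R‖_F² ≤ 4φ²R` for
`l = 1, …, L-1` and `‖∇_L R‖_F² ≤ 2Lφ²R`. -/
theorem gradient_upper_bounds
    (d L : ℕ) (hd : 1 ≤ d) (hL : 2 ≤ L)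
    (Φ : Matrix (Fin d) (Fin d) ℝ) (φ : ℝ) (hφ : 0 < φ)
    (W : ℕ → Matrix (Fin d) (Fin d) ℝ) (α β : ℝ)
    (hW : ∀ l, 1 ≤ l → l ≤ L - 1 → spec (W l) ≤ α)
    (hWL : spec (W L) ≤ β)
    (hα1 : 1 ≤ α^(2*(L-1))) (hα2 : α^(2*(L-1)) < L * φ^2)
    (hβ : α^(2*(L-1)) * β^2 < 2 * φ^2) :
    (∀ l, 1 ≤ l → l ≤ L - 1 → frobSq (grad W Φ L l) ≤ 4 * φ^2 * loss W Φ L)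
    ∧ frobSq (grad W Φ L L) ≤ 2 * L * φ^2 * loss W Φ L := by
  obtain ⟨N, rfl⟩ : ∃ N, L = N + 1 := ⟨L - 1, by omega⟩
  simp only [Nat.add_sub_cancel] at *
  have hα0 : 0 ≤ α := (spec_nonneg _).trans (hW 1 le_rfl (by omega))
  have hα : 1 ≤ α := by
    by_contra! h
    exact absurd hα1 (not_le.2 (pow_lt_one₀ hα0 h (by omega)))
  have hβ0 : 0 ≤ β := (spec_nonneg _).trans hWL
  have hF := frobSq_nonneg (seg W 1 (N + 1) - Φ)
  have prefix_le : ∀ l, 1 ≤ l → l ≤ N + 1 → spec (seg W 1 (l - 1)) ≤ α ^ (l - 1) := by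
    intro l h₁ h₂
    simpa using spec_seg_le hα0 (k := l - 1) le_rfl fun j hj₁ hj₂ => hW j hj₁ (by omega)
  unfold loss grad
  refine ⟨fun l hl₁ hl₂ => ?_, ?_⟩
  · have suffix_le : spec (seg W (l + 1) (N + 1)) ≤ β * α ^ (N - l) := by
      rw [seg_succ W (by omega)]
      refine (spec_mul_le _ _).trans (mul_le_mul hWL ?_ (spec_nonneg _) hβ0)
      simpa using spec_seg_le hα0 (l := l + 1) (k := N) (by omega)
        fun j hj₁ hj₂ => hW j (by omega) hj₂
    have hprod : spec (seg W (l + 1) (N + 1)) * spec (seg W 1 (l - 1)) ≤ α ^ N * β :=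
      calc _ ≤ (β * α ^ (N - l)) * α ^ (l - 1) :=
            mul_le_mul suffix_le (prefix_le l hl₁ (by omega)) (spec_nonneg _) (by positivity)
        _ = α ^ (N - l + (l - 1)) * β := by rw [pow_add]; ring
        _ ≤ α ^ N * β :=
            mul_le_mul_of_nonneg_right (pow_le_pow_right₀ hα (by omega)) hβ0
    have hsq : (spec (seg W (l + 1) (N + 1)) * spec (seg W 1 (l - 1))) ^ 2 ≤ 2 * φ ^ 2 :=
      calc _ ≤ (α ^ N * β) ^ 2 :=
            pow_le_pow_left₀ (mul_nonneg (spec_nonneg _) (spec_nonneg _)) hprod 2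
        _ = α ^ (2 * N) * β ^ 2 := by ring
        _ ≤ 2 * φ ^ 2 := hβ.le
    calc _ ≤ _ := frobSq_transpose_mul_mul_transpose_le _ _ _
      _ ≤ 2 * φ ^ 2 * frobSq (seg W 1 (N + 1) - Φ) := mul_le_mul_of_nonneg_right hsq hF
      _ = _ := by ring
  · have hprod : spec (seg W (N + 1 + 1) (N + 1)) * spec (seg W 1 N) ≤ 1 * α ^ N := by
      rw [seg_of_lt W (Nat.lt_succ_self _)]
      exact mul_le_mul spec_one_le (prefix_le (N + 1) (by omega) le_rfl) (spec_nonneg _)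
        zero_le_one
    have hsq : (spec (seg W (N + 1 + 1) (N + 1)) * spec (seg W 1 N)) ^ 2
        ≤ ((N + 1 : ℕ) : ℝ) * φ ^ 2 :=
      calc _ ≤ (1 * α ^ N) ^ 2 :=
            pow_le_pow_left₀ (mul_nonneg (spec_nonneg _) (spec_nonneg _)) hprod 2
        _ = α ^ (2 * N) := by ring
        _ ≤ _ := hα2.le
    calc _ ≤ _ := frobSq_transpose_mul_mul_transpose_le _ _ _
      _ ≤ ((N + 1 : ℕ) : ℝ) * φ ^ 2 * frobSq (seg W 1 (N + 1) - Φ) :=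
          mul_le_mul_of_nonneg_right hsq hF
      _ = _ := by ring
end
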